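/- arXiv:2410.02994 — 2 statements merged into one kernel-verified Lean document; each statement's English description precedes it below -/
import Mathlib

section
/- Componentwise lower bound on the value gap of a policy: let π_★ be an optimal policy (v_{π_★} = v_★), assume Δ_★ > 0, and for any policy π define χ_π ∈ {0,1}^S by χ_π(s) = 1 if π(s) does not maximize q_{π_★}(s,·) and χ_π(s) = 0 otherwise. Then componentwise v_★ − v_π ≥ Δ_★ (I − Q_π)^{-1} χ_π. -/
open Filter Matrix

noncomputable section

namespace MCES

variable {S A : Type*} [Fintype S] [DecidableEq S] [Fintype A] [Nonempty S] [Nonempty A]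

/-- The substochastic transition matrix on non-terminal states induced by a policy. -/
def Qmat (p : S → A → S → ℝ) (π : S → A) : Matrix S S ℝ := fun s s' => p s (π s) s'

/-- The reward vector induced by a policy. -/
def rvec (r : S → A → ℝ) (π : S → A) : S → ℝ := fun s => r s (π s)

/-- Value function of a policy: `v_π = (I − Q_π)⁻¹ r_π`. -/
def valueFn (p : S → A → S → ℝ) (r : S → A → ℝ) (π : S → A) : S → ℝ :=
  (1 - Qmat p π)⁻¹ *ᵥ rvec r π

/-- Action-value function of a policy:
`q_π(s,a) = r(s,a) + ∑_{s'} p(s'|s,a) v_π(s')`. -/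
def qFn (p : S → A → S → ℝ) (r : S → A → ℝ) (π : S → A) (s : S) (a : A) : ℝ :=
  r s a + ∑ s', p s a s' * valueFn p r π s'

/-- The optimal value function `v_★(s) = max_π v_π(s)`. -/
def vStar (p : S → A → S → ℝ) (r : S → A → ℝ) (s : S) : ℝ :=
  ⨆ π : S → A, valueFn p r π s

/-- The optimal action-value function `q_★(s,a) = max_π q_π(s,a)`. -/
def qStar (p : S → A → S → ℝ) (r : S → A → ℝ) (s : S) (a : A) : ℝ :=
  ⨆ π : S → A, qFn p r π s a

/-- A policy is optimal if its value function equals the optimal value function. -/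
def IsOptimal (p : S → A → S → ℝ) (r : S → A → ℝ) (π : S → A) : Prop :=
  ∀ s, valueFn p r π s = vStar p r s

/-- A policy `π'` is greedy w.r.t. `Q : S → A → ℝ` if `π' s` maximizes `Q s ·`
for every state `s`. -/
def IsGreedy (Q : S → A → ℝ) (π' : S → A) : Prop := ∀ s a, Q s a ≤ Q s (π' s)

/-- The vector `w`: maximal expected episode length, `w(s) = max_π ((I−Q_π)⁻¹ 𝟙)(s)`. -/
def wVec (p : S → A → S → ℝ) (s : S) : ℝ :=
  ⨆ π : S → A, ((1 - Qmat p π)⁻¹ *ᵥ (fun _ => (1 : ℝ))) s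

/-- `‖w‖_∞ = max_s w(s)`. -/
def wNorm (p : S → A → S → ℝ) : ℝ := ⨆ s : S, wVec p s

/-- The suboptimality gap of an action-value function `q`:
`min_s [max_a q(s,a) − max_{a not maximizing q(s,·)} q(s,a)]`. -/
def gapOf (q : S → A → ℝ) : ℝ :=
  ⨅ s : S, ((⨆ a : A, q s a) - sSup (q s '' {a | q s a < ⨆ a' : A, q s a'}))

/-- The optimal suboptimality gap `Δ_★`. -/
def gapStar (p : S → A → S → ℝ) (r : S → A → ℝ) : ℝ := gapOf (qStar p r)

/-- The minimum suboptimality gap `Δ = min_π Δ(π)`. -/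
def gapMin (p : S → A → S → ℝ) (r : S → A → ℝ) : ℝ :=
  ⨅ π : S → A, gapOf (qFn p r π)

/-- All policies are proper: `Q_π^k → 0` entrywise as `k → ∞` for every policy. -/
def AllProper (p : S → A → S → ℝ) : Prop :=
  ∀ π : S → A, Tendsto (fun k => (Qmat p π) ^ k) atTop (nhds 0)

/-- `p` is a family of subprobability vectors and `r` takes values in `[0,1]`. -/
def IsMDP (p : S → A → S → ℝ) (r : S → A → ℝ) : Prop :=
  (∀ s a, r s a ∈ Set.Icc (0 : ℝ) 1) ∧ (∀ s a s', 0 ≤ p s a s') ∧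
    (∀ s a, ∑ s', p s a s' ≤ 1)

end MCES

open MCES
open scoped Classical

/-- A discrete maximum principle: if `Q ≥ 0` and `Q ^ k → 0`, then `Q u ≤ u` forces `0 ≤ u`. -/
theorem MCES.nonneg_of_mulVec_le {S : Type*} [Fintype S] [DecidableEq S]
    {Q : Matrix S S ℝ} (hQ : ∀ i j, 0 ≤ Q i j)
    (hlim : Tendsto (fun k => Q ^ k) atTop (nhds 0))
    {u : S → ℝ} (hu : Q *ᵥ u ≤ u) : 0 ≤ u := by
  have hmono : Monotone (fun x : S → ℝ => Q *ᵥ x) := fun x y hxy i =>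
    Finset.sum_le_sum fun j _ => mul_le_mul_of_nonneg_left (hxy j) (hQ i j)
  have hpow : ∀ k, (Q ^ k) *ᵥ u ≤ u := by
    intro k
    induction k with
    | zero => simp
    | succ k ih =>
      rw [pow_succ', ← mulVec_mulVec]
      exact (hmono ih).trans hu
  have htend : Tendsto (fun k => (Q ^ k) *ᵥ u) atTop (nhds ((0 : Matrix S S ℝ) *ᵥ u)) :=
    ((continuous_id.matrix_mulVec continuous_const).tendsto _).comp hlim
  rw [zero_mulVec] at htend
  exact le_of_tendsto' htend hpow

theorem MCES.isUnit_det_one_sub {S : Type*} [Fintype S] [DecidableEq S]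
    {Q : Matrix S S ℝ} (hQ : ∀ i j, 0 ≤ Q i j)
    (hlim : Tendsto (fun k => Q ^ k) atTop (nhds 0)) : IsUnit (1 - Q).det := by
  rw [isUnit_iff_ne_zero]
  intro hdet
  obtain ⟨u, hu0, hu⟩ := exists_mulVec_eq_zero_iff.mpr hdet
  rw [sub_mulVec, one_mulVec, sub_eq_zero] at hu
  have h₁ : 0 ≤ u := nonneg_of_mulVec_le hQ hlim hu.ge
  have h₂ : 0 ≤ -u := nonneg_of_mulVec_le hQ hlim (by rw [mulVec_neg, ← hu])
  exact hu0 (le_antisymm (neg_nonneg.mp h₂) h₁)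

theorem MCES.inv_one_sub_mulVec_eq {S : Type*} [Fintype S] [DecidableEq S]
    {Q : Matrix S S ℝ} (hQ : ∀ i j, 0 ≤ Q i j)
    (hlim : Tendsto (fun k => Q ^ k) atTop (nhds 0)) (b : S → ℝ) :
    (1 - Q)⁻¹ *ᵥ b = b + Q *ᵥ ((1 - Q)⁻¹ *ᵥ b) := by
  have h : (1 - Q) *ᵥ ((1 - Q)⁻¹ *ᵥ b) = b := by
    rw [mulVec_mulVec, mul_nonsing_inv _ (isUnit_det_one_sub hQ hlim), one_mulVec]
  rw [sub_mulVec, one_mulVec] at h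
  exact sub_eq_iff_eq_add.mp h

/-- Subsolutions of `x = b + Q x` lie below the solution `(1 - Q)⁻¹ b`. -/
theorem MCES.le_inv_one_sub_mulVec {S : Type*} [Fintype S] [DecidableEq S]
    {Q : Matrix S S ℝ} (hQ : ∀ i j, 0 ≤ Q i j)
    (hlim : Tendsto (fun k => Q ^ k) atTop (nhds 0)) {b x : S → ℝ}
    (hx : x ≤ b + Q *ᵥ x) : x ≤ (1 - Q)⁻¹ *ᵥ b := by
  refine sub_nonneg.mp (nonneg_of_mulVec_le hQ hlim fun i => ?_)
  have h := congrFun (inv_one_sub_mulVec_eq hQ hlim b) i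
  have hxi := hx i
  simp only [mulVec_sub, Pi.sub_apply, Pi.add_apply] at h hxi ⊢
  linarith

/-- Supersolutions of `x = b + Q x` lie above the solution `(1 - Q)⁻¹ b`. -/
theorem MCES.inv_one_sub_mulVec_le {S : Type*} [Fintype S] [DecidableEq S]
    {Q : Matrix S S ℝ} (hQ : ∀ i j, 0 ≤ Q i j)
    (hlim : Tendsto (fun k => Q ^ k) atTop (nhds 0)) {b x : S → ℝ}
    (hx : b + Q *ᵥ x ≤ x) : (1 - Q)⁻¹ *ᵥ b ≤ x := by
  have h : -x ≤ (1 - Q)⁻¹ *ᵥ (-b) := le_inv_one_sub_mulVec hQ hlim (by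
    rw [mulVec_neg, ← neg_add]
    exact neg_le_neg hx)
  rw [mulVec_neg] at h
  exact neg_le_neg_iff.mp h

theorem MCES.Qmat_nonneg {S A : Type*} {p : S → A → S → ℝ} (hp : ∀ s a s', 0 ≤ p s a s')
    (π : S → A) (i j : S) : 0 ≤ Qmat p π i j := hp i (π i) j

theorem MCES.qFn_apply_policy {S A : Type*} [Fintype S] [DecidableEq S]
    (p : S → A → S → ℝ) (r : S → A → ℝ) (π π' : S → A) (s : S) :
    qFn p r π s (π' s) = (rvec r π' + Qmat p π' *ᵥ valueFn p r π) s := rfl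

theorem MCES.qFn_self {S A : Type*} [Fintype S] [DecidableEq S]
    {p : S → A → S → ℝ} (r : S → A → ℝ) (hp : ∀ s a s', 0 ≤ p s a s')
    (hproper : AllProper p) (π : S → A) (s : S) :
    qFn p r π s (π s) = valueFn p r π s :=
  (congrFun (inv_one_sub_mulVec_eq (Qmat_nonneg hp π) (hproper π) (rvec r π)) s).symm

/-- The Bellman optimality equation. -/
theorem MCES.iSup_qFn_eq_valueFn {S A : Type*} [Fintype S] [DecidableEq S] [Fintype A]
    [Nonempty A] {p : S → A → S → ℝ} {r : S → A → ℝ} (hp : ∀ s a s', 0 ≤ p s a s')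
    (hproper : AllProper p) {π : S → A} (hopt : ∀ s, valueFn p r π s = vStar p r s) (s : S) :
    ⨆ a, qFn p r π s a = valueFn p r π s := by
  choose g hg using fun s => exists_eq_ciSup_of_finite (f := qFn p r π s)
  have hle : ∀ s a, qFn p r π s a ≤ ⨆ a', qFn p r π s a' := fun s a =>
    le_ciSup (Set.finite_range _).bddAbove a
  have himp : valueFn p r π ≤ valueFn p r g :=
    le_inv_one_sub_mulVec (Qmat_nonneg hp g) (hproper g) fun i => by
      rw [← qFn_apply_policy, hg, ← qFn_self r hp hproper π i]
      exact hle i _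
  have heq : valueFn p r g = valueFn p r π := by
    refine le_antisymm (fun i => ?_) himp
    rw [hopt]
    exact le_ciSup (f := fun π' : S → A => valueFn p r π' i) (Set.finite_range _).bddAbove g
  rw [← hg s, qFn_apply_policy, ← heq, ← qFn_apply_policy, qFn_self r hp hproper]

theorem MCES.gapOf_le_iSup_sub {S A : Type*} [Fintype S] [Fintype A] (q : S → A → ℝ)
    {s : S} {a : A} (ha : q s a < ⨆ a', q s a') :
    gapOf q ≤ (⨆ a', q s a') - q s a := by
  have hsSup : q s a ≤ sSup (q s '' {b | q s b < ⨆ a', q s a'}) :=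
    le_csSup (Set.toFinite _).bddAbove ⟨a, ha, rfl⟩
  exact (ciInf_le (Set.finite_range _).bddBelow s).trans (sub_le_sub_left hsSup _)

/-- **Componentwise lower bound on the value gap of a policy.**
Let `π_★` be an optimal policy (`v_{π_★} = v_★`) with `Δ_★ > 0`, and for a
policy `π` let `χ_π(s) = 1` if `π s` does not maximize `q_{π_★}(s,·)` and `0`
otherwise.  Then componentwise `v_★ − v_π ≥ Δ_★ (I − Q_π)⁻¹ χ_π`. -/
theorem value_gap_componentwise_lower_bound
    {S A : Type*} [Fintype S] [DecidableEq S] [Fintype A] [Nonempty S] [Nonempty A]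
    (p : S → A → S → ℝ) (r : S → A → ℝ)
    (hmdp : IsMDP p r) (hproper : AllProper p)
    (πstar : S → A) (hopt : ∀ s, valueFn p r πstar s = vStar p r s)
    (hsubopt : ∀ s : S, ∃ a, qFn p r πstar s a < ⨆ a' : A, qFn p r πstar s a')
    (hΔ : 0 < gapOf (qFn p r πstar))
    (π : S → A) (s : S) :
    gapOf (qFn p r πstar) *
        ((1 - Qmat p π)⁻¹ *ᵥ
          (fun s' => if qFn p r πstar s' (π s') < ⨆ a : A, qFn p r πstar s' a
            then (1 : ℝ) else 0)) s ≤
      vStar p r s - valueFn p r π s := by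
  have hp := hmdp.2.1
  set Δ := gapOf (qFn p r πstar)
  set χ : S → ℝ := fun s' => if qFn p r πstar s' (π s') < ⨆ a : A, qFn p r πstar s' a
    then (1 : ℝ) else 0 with hχ
  have hle : (1 - Qmat p π)⁻¹ *ᵥ (rvec r π + Δ • χ) ≤ valueFn p r πstar := by
    refine inv_one_sub_mulVec_le (Qmat_nonneg hp π) (hproper π) fun i => ?_
    rw [add_right_comm, Pi.add_apply, ← qFn_apply_policy,
      ← iSup_qFn_eq_valueFn hp hproper hopt i, Pi.smul_apply, smul_eq_mul]
    by_cases hi : qFn p r πstar i (π i) < ⨆ a : A, qFn p r πstar i a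
    · simp only [hχ, if_pos hi]
      linarith [gapOf_le_iSup_sub _ hi]
    · simpa only [hχ, if_neg hi, mul_zero, add_zero] using
        le_ciSup (Set.finite_range _).bddAbove (π i)
  have hs := hle s
  rw [mulVec_add, mulVec_smul, Pi.add_apply, Pi.smul_apply, smul_eq_mul, hopt s] at hs
  change valueFn p r π s + _ ≤ _ at hs
  linarith
end
end

section
/- Separation of suboptimal policies from the optimal value function in the weighted sup-norm: let π_★ be an optimal policy (v_{π_★} = v_★) and assume Δ_★ > 0. Then for every policy π that is not optimal, ‖v_★ − v_π‖_w ≥ Δ_★/‖w‖_∞; consequently min over non-optimal policies π of ‖v_★ − v_π‖_w is at least Δ_★/‖w‖_∞. -/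
open Filter Matrix

noncomputable section

open MCES

namespace MCES

variable {S A : Type*} [Fintype S]

theorem mulVec_mono_of_nonneg {M : Matrix S S ℝ} (hM : ∀ i j, 0 ≤ M i j) {x y : S → ℝ}
    (hxy : x ≤ y) : M *ᵥ x ≤ M *ᵥ y := fun i =>
  Finset.sum_le_sum fun j _ => mul_le_mul_of_nonneg_left (hxy j) (hM i j)

theorem gapOf_le_sub [Fintype A] (q : S → A → ℝ) {s : S} {a b : A} (hb : ∀ a', q s a' ≤ q s b)
    (hab : q s a < q s b) : gapOf q ≤ q s b - q s a := by
  have : Nonempty A := ⟨a⟩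
  have hmax : ⨆ a', q s a' = q s b :=
    le_antisymm (ciSup_le hb) (le_ciSup (Set.finite_range _).bddAbove b)
  have hmem : q s a ≤ sSup (q s '' {a | q s a < ⨆ a', q s a'}) :=
    le_csSup (Set.toFinite _).bddAbove ⟨a, by simpa [hmax] using hab, rfl⟩
  calc gapOf q ≤ (⨆ a', q s a') - sSup (q s '' {a | q s a < ⨆ a', q s a'}) :=
        ciInf_le (Set.finite_range _).bddBelow s
    _ ≤ q s b - q s a := by rw [hmax] at hmem ⊢; linarith

variable [DecidableEq S]

/-- A vector dominating its image under a nonnegative matrix with vanishing powers is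
nonnegative. -/
theorem nonneg_of_mulVec_le_s11 {M : Matrix S S ℝ} (hM : ∀ i j, 0 ≤ M i j)
    (hlim : Tendsto (fun k => M ^ k) atTop (nhds 0)) {x : S → ℝ} (hx : M *ᵥ x ≤ x) :
    0 ≤ x := by
  have hpow : ∀ k : ℕ, (M ^ k) *ᵥ x ≤ x := by
    intro k
    induction k with
    | zero => simp
    | succ k ih =>
      rw [pow_succ', ← Matrix.mulVec_mulVec]
      exact (mulVec_mono_of_nonneg hM ih).trans hx
  have hcont : Continuous fun N : Matrix S S ℝ => N *ᵥ x := by fun_prop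
  have hlim' : Tendsto (fun k => (M ^ k) *ᵥ x) atTop (nhds 0) := by
    simpa [Function.comp_def] using (hcont.tendsto 0).comp hlim
  exact le_of_tendsto' hlim' hpow

theorem isUnit_one_sub {M : Matrix S S ℝ} (hM : ∀ i j, 0 ≤ M i j)
    (hlim : Tendsto (fun k => M ^ k) atTop (nhds 0)) : IsUnit (1 - M) := by
  rw [← Matrix.mulVec_injective_iff_isUnit]
  intro x y hxy
  have hfix : M *ᵥ (x - y) = x - y := by
    simp only [Matrix.sub_mulVec, Matrix.one_mulVec] at hxy
    rw [Matrix.mulVec_sub]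
    linear_combination -hxy
  have hpos := nonneg_of_mulVec_le_s11 hM hlim hfix.le
  have hneg : 0 ≤ -(x - y) :=
    nonneg_of_mulVec_le_s11 hM hlim (by rw [Matrix.mulVec_neg, hfix])
  exact sub_eq_zero.mp (le_antisymm (neg_nonneg.mp hneg) hpos)

theorem inv_one_sub_mulVec_eq_s11 {M : Matrix S S ℝ} (hM : ∀ i j, 0 ≤ M i j)
    (hlim : Tendsto (fun k => M ^ k) atTop (nhds 0)) (b : S → ℝ) :
    (1 - M)⁻¹ *ᵥ b = b + M *ᵥ ((1 - M)⁻¹ *ᵥ b) := by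
  have hdet := (Matrix.isUnit_iff_isUnit_det _).mp (isUnit_one_sub hM hlim)
  have h : (1 - M) *ᵥ ((1 - M)⁻¹ *ᵥ b) = b := by
    rw [Matrix.mulVec_mulVec, Matrix.mul_nonsing_inv _ hdet, Matrix.one_mulVec]
  rw [Matrix.sub_mulVec, Matrix.one_mulVec] at h
  exact sub_eq_iff_eq_add.mp h

/-- Bellman equation for a policy. -/
theorem valueFn_eq_qFn {p : S → A → S → ℝ} (hp : ∀ s a s', 0 ≤ p s a s')
    (hproper : AllProper p) (r : S → A → ℝ) (π : S → A) (s : S) :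
    valueFn p r π s = qFn p r π s (π s) :=
  congrFun (inv_one_sub_mulVec_eq_s11 (fun i j => hp i (π i) j) (hproper π) (rvec r π)) s

/-- One-step lookahead difference of two policies along the actions of the second. -/
theorem qFn_sub_qFn (p : S → A → S → ℝ) (r : S → A → ℝ) (π π' : S → A) (s : S) :
    qFn p r π' s (π' s) - qFn p r π s (π' s) =
      (Qmat p π' *ᵥ (valueFn p r π' - valueFn p r π)) s := by
  simp [qFn, Qmat, Matrix.mulVec, dotProduct, mul_sub, Finset.sum_sub_distrib]

/-- Policy improvement: a policy whose one-step lookahead does not decrease the value of `π`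
is at least as good as `π`. -/
theorem valueFn_le_of_le_qFn {p : S → A → S → ℝ} (hp : ∀ s a s', 0 ≤ p s a s')
    (hproper : AllProper p) {r : S → A → ℝ} {π π' : S → A}
    (h : ∀ s, valueFn p r π s ≤ qFn p r π s (π' s)) :
    valueFn p r π ≤ valueFn p r π' := by
  rw [← sub_nonneg]
  refine nonneg_of_mulVec_le_s11 (M := Qmat p π') (fun i j => hp i (π' i) j) (hproper π')
    fun s => ?_
  rw [← qFn_sub_qFn, ← valueFn_eq_qFn hp hproper, Pi.sub_apply]
  linarith [h s]

/-- If `π'` attains the value of `π` by one-step lookahead, the two values agree. -/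
theorem valueFn_eq_of_eq_qFn {p : S → A → S → ℝ} (hp : ∀ s a s', 0 ≤ p s a s')
    (hproper : AllProper p) {r : S → A → ℝ} {π π' : S → A}
    (h : ∀ s, valueFn p r π s = qFn p r π s (π' s)) :
    valueFn p r π' = valueFn p r π := by
  refine le_antisymm ?_ (valueFn_le_of_le_qFn hp hproper fun s => (h s).le)
  rw [← sub_nonneg]
  refine nonneg_of_mulVec_le_s11 (M := Qmat p π') (fun i j => hp i (π' i) j) (hproper π')
    fun s => ?_
  rw [← neg_sub, Matrix.mulVec_neg, Pi.neg_apply, ← qFn_sub_qFn,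
    ← valueFn_eq_qFn hp hproper, Pi.neg_apply, Pi.sub_apply]
  linarith [h s]

theorem le_qFn_of_valueFn_le {p : S → A → S → ℝ} (hp : ∀ s a s', 0 ≤ p s a s')
    {r : S → A → ℝ} {π π' : S → A} (h : valueFn p r π ≤ valueFn p r π') (s : S) (a : A) :
    qFn p r π s a ≤ qFn p r π' s a := by
  unfold qFn
  gcongr with s' _
  · exact hp s a s'
  · exact h s'

variable [Fintype A]

theorem valueFn_le_vStar (p : S → A → S → ℝ) (r : S → A → ℝ) (π : S → A) (s : S) :
    valueFn p r π s ≤ vStar p r s :=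
  le_ciSup (f := fun π => valueFn p r π s) (Set.finite_range _).bddAbove π

/-- An optimal policy satisfies the Bellman optimality inequality. -/
theorem qFn_le_valueFn_of_isOptimal [Nonempty A] {p : S → A → S → ℝ}
    (hp : ∀ s a s', 0 ≤ p s a s') (hproper : AllProper p) {r : S → A → ℝ} {π : S → A}
    (hopt : IsOptimal p r π) (s : S) (a : A) : qFn p r π s a ≤ valueFn p r π s := by
  choose π' hπ' using fun s => Finite.exists_max (qFn p r π s)
  have himp : valueFn p r π ≤ valueFn p r π' :=
    valueFn_le_of_le_qFn hp hproper fun s =>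
      (valueFn_eq_qFn hp hproper r π s).trans_le (hπ' s _)
  calc qFn p r π s a ≤ qFn p r π s (π' s) := hπ' s a
    _ ≤ qFn p r π' s (π' s) := le_qFn_of_valueFn_le hp himp s _
    _ = valueFn p r π' s := (valueFn_eq_qFn hp hproper r π' s).symm
    _ ≤ valueFn p r π s := (valueFn_le_vStar p r π' s).trans_eq (hopt s).symm

theorem wVec_pos [Nonempty A] {p : S → A → S → ℝ} (hp : ∀ s a s', 0 ≤ p s a s')
    (hproper : AllProper p) (s : S) : 0 < wVec p s := by
  obtain ⟨π⟩ : Nonempty (S → A) := inferInstance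
  set x : S → ℝ := (1 - Qmat p π)⁻¹ *ᵥ (fun _ => (1 : ℝ)) with hx
  have hQ : ∀ i j, 0 ≤ Qmat p π i j := fun i j => hp i (π i) j
  have hfix : ∀ s, x s = 1 + (Qmat p π *ᵥ x) s :=
    congrFun (inv_one_sub_mulVec_eq_s11 hQ (hproper π) _)
  have hx0 : 0 ≤ x :=
    nonneg_of_mulVec_le_s11 hQ (hproper π) fun s => by linarith [hfix s]
  have hQx : 0 ≤ (Qmat p π *ᵥ x) s := by
    simpa using mulVec_mono_of_nonneg hQ hx0 s
  have hle : x s ≤ wVec p s :=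
    le_ciSup (f := fun π => ((1 - Qmat p π)⁻¹ *ᵥ (fun _ => (1 : ℝ))) s)
      (Set.finite_range _).bddAbove π
  linarith [hfix s]

end MCES

/-- **Separation of suboptimal policies from the optimal value function in the
weighted sup-norm.**  Let `π_★` be an optimal policy (`v_{π_★} = v_★`) with
`Δ_★ > 0`.  Then for every policy `π` that is not optimal,
`‖v_★ − v_π‖_w ≥ Δ_★ / ‖w‖_∞`, where `‖v‖_w := max_s |v s| / w s`. -/
theorem suboptimal_policy_separation
    {S A : Type*} [Fintype S] [DecidableEq S] [Fintype A] [Nonempty S] [Nonempty A]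
    (p : S → A → S → ℝ) (r : S → A → ℝ)
    (hmdp : IsMDP p r) (hproper : AllProper p)
    (πstar : S → A) (hopt : ∀ s, valueFn p r πstar s = vStar p r s)
    (hsubopt : ∀ s : S, ∃ a, qFn p r πstar s a < ⨆ a' : A, qFn p r πstar s a')
    (hΔ : 0 < gapOf (qFn p r πstar)) :
    ∀ π : S → A, ¬ IsOptimal p r π →
      gapOf (qFn p r πstar) / wNorm p ≤
        ⨆ s : S, |vStar p r s - valueFn p r π s| / wVec p s := by
  intro π hπ
  have hp := hmdp.2.1
  have hbell := valueFn_eq_qFn hp hproper r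
  have hle := qFn_le_valueFn_of_isOptimal hp hproper hopt
  obtain ⟨s, hs⟩ : ∃ s, qFn p r πstar s (π s) < valueFn p r πstar s := by
    by_contra! hall
    have heq := valueFn_eq_of_eq_qFn hp hproper fun s => le_antisymm (hall s) (hle s (π s))
    exact hπ fun s => (congrFun heq s).trans (hopt s)
  have hgap : gapOf (qFn p r πstar) ≤ valueFn p r πstar s - qFn p r πstar s (π s) := by
    rw [hbell πstar s] at hs ⊢
    exact gapOf_le_sub _ (fun a => (hle s a).trans_eq (hbell πstar s)) hs
  have hval : valueFn p r π s ≤ qFn p r πstar s (π s) :=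
    (hbell π s).trans_le <| le_qFn_of_valueFn_le hp
      (fun s' => (valueFn_le_vStar p r π s').trans_eq (hopt s').symm) s _
  have hw := wVec_pos hp hproper s
  calc gapOf (qFn p r πstar) / wNorm p
      ≤ gapOf (qFn p r πstar) / wVec p s :=
        div_le_div_of_nonneg_left hΔ.le hw (le_ciSup (Set.finite_range _).bddAbove s)
    _ ≤ |vStar p r s - valueFn p r π s| / wVec p s := by
        gcongr
        rw [← hopt s]
        exact le_abs.mpr (Or.inl (by linarith))
    _ ≤ ⨆ s : S, |vStar p r s - valueFn p r π s| / wVec p s :=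
        le_ciSup (f := fun s => |vStar p r s - valueFn p r π s| / wVec p s)
          (Set.finite_range _).bddAbove s
end
end
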